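/- arXiv:2512.01005 — 2 statements merged into one kernel-verified Lean document; each statement's English description precedes it below -/
import Mathlib

section
/- Let a₀, a₁, a₂, b₀, b₁ be real numbers with a₁ ≠ 0 and a₂ ≠ 0. Let T : ℕ → ℤ → ℝ satisfy T(0,0) = 1, T(n,k) = 0 whenever k < 0 or k > n, and for all n ≥ 1 and 0 ≤ k ≤ n the recurrence T(n,k) = (a₂·n + a₁·k + a₀)·T(n-1,k) + (b₁·k + b₀)·T(n-1,k-1). Then for all n and all 0 ≤ k ≤ n, T(n,k) = (∏_{i=1}^{k} (b₀ + i·b₁)) · (1/(a₁^k · k!)) · ∑_{j=0}^{k} (-1)^{k-j} · C(k,j) · ∏_{r=1}^{n} (a₀ + a₁·j + r·a₂). -/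
/-- The alternating binomial sum `∑ j ≤ k, (-1) ^ (k - j) * C(k, j) * f j`. -/
def altBinomSum (f : ℕ → ℝ) (k : ℕ) : ℝ :=
  ∑ j ∈ Finset.range (k + 1), (-1 : ℝ) ^ (k - j) * (Nat.choose k j : ℝ) * f j

theorem altBinomSum_one (k : ℕ) : altBinomSum (fun _ => 1) k = 0 ^ k := by
  have h := add_pow (1 : ℝ) (-1) k
  simp only [add_neg_cancel, one_pow, one_mul] at h
  simp only [altBinomSum, mul_one, h]

theorem altBinomSum_zero_linear_mul (a c : ℝ) (f : ℕ → ℝ) :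
    altBinomSum (fun j => (c + a * j) * f j) 0 = c * altBinomSum f 0 := by
  simp [altBinomSum]

theorem altBinomSum_succ_linear_mul (a c : ℝ) (f : ℕ → ℝ) (k : ℕ) :
    altBinomSum (fun j => (c + a * j) * f j) (k + 1) =
      (c + a * (k + 1)) * altBinomSum f (k + 1) + a * (k + 1) * altBinomSum f k := by
  unfold altBinomSum
  rw [Finset.sum_range_succ, Finset.sum_range_succ _ (k + 1), mul_add, Finset.mul_sum,
    Finset.mul_sum, add_right_comm, ← Finset.sum_add_distrib]
  congr 1
  · refine Finset.sum_congr rfl fun j hj => ?_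
    have hjk : j ≤ k := Nat.lt_succ_iff.mp (Finset.mem_range.mp hj)
    have hc : ((k : ℝ) + 1) * (k.choose j : ℝ) = ((k + 1).choose j : ℝ) * (k + 1 - j) := by
      have h := Nat.choose_mul_succ_eq k j
      rw [← Nat.cast_inj (R := ℝ)] at h
      push_cast [Nat.cast_sub (Nat.le_succ_of_le hjk)] at h
      linarith
    rw [Nat.succ_sub hjk, pow_succ]
    linear_combination -a * (-1) ^ (k - j) * f j * hc
  · push_cast
    ring

theorem stmt_1 (a₀ a₁ a₂ b₀ b₁ : ℝ) (ha₁ : a₁ ≠ 0) (ha₂ : a₂ ≠ 0)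
    (T : ℕ → ℤ → ℝ)
    (hinit : T 0 0 = 1)
    (hzero : ∀ (n : ℕ) (k : ℤ), (k < 0 ∨ (n : ℤ) < k) → T n k = 0)
    (hrec : ∀ n : ℕ, 1 ≤ n → ∀ k : ℤ, 0 ≤ k → k ≤ (n : ℤ) →
      T n k = (a₂ * n + a₁ * k + a₀) * T (n - 1) k + (b₁ * k + b₀) * T (n - 1) (k - 1)) :
    ∀ n k : ℕ, k ≤ n →
      T n k = (∏ i ∈ Finset.Icc 1 k, (b₀ + i * b₁)) *
        ((1 / (a₁ ^ k * (Nat.factorial k : ℝ))) *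
          ∑ j ∈ Finset.range (k + 1),
            (-1 : ℝ) ^ (k - j) * (Nat.choose k j : ℝ) *
              ∏ r ∈ Finset.Icc 1 n, (a₀ + a₁ * j + r * a₂)) := by
  have key : ∀ n k : ℕ, T n k = (∏ i ∈ Finset.Icc 1 k, (b₀ + i * b₁)) *
      ((1 / (a₁ ^ k * (Nat.factorial k : ℝ))) *
        altBinomSum (fun j => ∏ r ∈ Finset.Icc 1 n, (a₀ + a₁ * j + r * a₂)) k) := by
    intro n
    induction n with
    | zero =>
      rintro (_ | k)
      · simp [altBinomSum, hinit]
      · rw [hzero 0 _ (Or.inr (by positivity))]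
        simp [altBinomSum_one]
    | succ n ih =>
      have hT : ∀ k : ℕ, T (n + 1) k =
          (a₂ * (n + 1) + a₁ * k + a₀) * T n k + (b₁ * k + b₀) * T n ((k : ℤ) - 1) := by
        intro k
        by_cases hk : k ≤ n + 1
        · simpa using hrec (n + 1) (by omega) k (by omega) (by omega)
        · rw [hzero _ _ (Or.inr (by omega)), hzero _ _ (Or.inr (by omega)),
            hzero _ _ (Or.inr (by omega))]
          ring
      have hP : (fun j : ℕ => ∏ r ∈ Finset.Icc 1 (n + 1), (a₀ + a₁ * j + r * a₂)) =
          fun j : ℕ => ((a₀ + (n + 1) * a₂) + a₁ * j) *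
            ∏ r ∈ Finset.Icc 1 n, (a₀ + a₁ * j + r * a₂) := by
        funext j
        rw [Finset.prod_Icc_succ_top (by omega)]
        push_cast
        ring
      rintro (_ | k)
      · rw [hT, ih, hP, altBinomSum_zero_linear_mul, hzero n _ (Or.inl (by simp))]
        push_cast
        ring
      · rw [hT, ih, hP, altBinomSum_succ_linear_mul,
          show ((k + 1 : ℕ) : ℤ) - 1 = k by simp, ih, Finset.prod_Icc_succ_top (by omega),
          Nat.factorial_succ]
        have hf : (k.factorial : ℝ) ≠ 0 := by positivity
        have hk : (k : ℝ) + 1 ≠ 0 := by positivity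
        generalize (∏ i ∈ Finset.Icc 1 k, (b₀ + i * b₁)) = B
        generalize altBinomSum _ (k + 1) = D'
        generalize altBinomSum _ k = D
        push_cast
        field_simp
        ring
  exact fun n k _ => key n k
end

section
/- Let a₀, a₁ be real numbers. Let F : ℕ → ℤ → ℝ satisfy F(0,0) = 1, F(n,k) = 0 whenever k < 0 or k > n, and for n ≥ 1, 0 ≤ k ≤ n the recurrence F(n,k) = (a₁·k + a₀)·F(n-1,k) + F(n-1,k-1). Then for all n and all 0 ≤ k ≤ n, F(n,k) = ∑_{j=k}^{n} C(n,j)·a₀^{n−j}·a₁^{j−k}·S(j,k), where S(j,k) are the Stirling numbers of the second kind. -/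
/-- The Stirling numbers of the second kind. -/
def stirling2 : ℕ → ℕ → ℕ
  | 0, 0 => 1
  | 0, _ + 1 => 0
  | _ + 1, 0 => 0
  | n + 1, k + 1 => (k + 1) * stirling2 n (k + 1) + stirling2 n k

theorem stirling2_eq_zero_of_lt : ∀ {n k : ℕ}, n < k → stirling2 n k = 0
  | _, 0, h => absurd h (Nat.not_lt_zero _)
  | 0, _ + 1, _ => by rw [stirling2]
  | n + 1, k + 1, h => by
    rw [stirling2, stirling2_eq_zero_of_lt (Nat.lt_of_succ_lt_succ h),
      stirling2_eq_zero_of_lt (Nat.lt_of_succ_lt h), mul_zero]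

theorem pow_mul_stirling2_succ_zero {R : Type*} [CommSemiring R] (a : R) (j : ℕ) :
    a ^ (j + 1 - 0) * (stirling2 (j + 1) 0 : R) = 0 := by
  simp [stirling2]

theorem pow_mul_stirling2_succ_succ {R : Type*} [CommSemiring R] (a : R) (j k : ℕ) :
    a ^ (j + 1 - (k + 1)) * (stirling2 (j + 1) (k + 1) : R) =
      a * (k + 1) * (a ^ (j - (k + 1)) * (stirling2 j (k + 1) : R)) +
        a ^ (j - k) * (stirling2 j k : R) := by
  rw [Nat.add_sub_add_right, stirling2]
  rcases lt_or_ge j (k + 1) with h | h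
  · simp [stirling2_eq_zero_of_lt h]
  · obtain ⟨d, rfl⟩ := Nat.exists_eq_add_of_le h
    rw [Nat.add_sub_cancel_left, show k + 1 + d - k = d + 1 by omega]
    push_cast
    ring

/-- Pascal's rule for the weighted binomial transform of a sequence. -/
theorem sum_range_choose_succ_mul_pow_mul {R : Type*} [CommSemiring R] (a : R) (u : ℕ → R)
    (n : ℕ) :
    ∑ j ∈ Finset.range (n + 2), ((n + 1).choose j : R) * a ^ (n + 1 - j) * u j =
      a * ∑ j ∈ Finset.range (n + 1), (n.choose j : R) * a ^ (n - j) * u j +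
        ∑ j ∈ Finset.range (n + 1), (n.choose j : R) * a ^ (n - j) * u (j + 1) := by
  have h := Finset.sum_antidiagonal_choose_succ_mul (fun i j => a ^ j * u i) n
  simp only [Finset.Nat.sum_antidiagonal_eq_sum_range_succ_mk] at h
  simp only [mul_assoc, Finset.mul_sum]
  rw [h]
  congr 1
  · refine Finset.sum_congr rfl fun j _ => ?_
    rw [pow_succ]
    ring
  · refine Finset.sum_congr rfl fun j hj => ?_
    rw [Nat.choose_symm (Nat.lt_succ_iff.mp (Finset.mem_range.mp hj))]

theorem stmt_8 (a₀ a₁ : ℝ)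
    (F : ℕ → ℤ → ℝ)
    (hinit : F 0 0 = 1)
    (hzero : ∀ (n : ℕ) (k : ℤ), (k < 0 ∨ (n : ℤ) < k) → F n k = 0)
    (hrec : ∀ n : ℕ, 1 ≤ n → ∀ k : ℤ, 0 ≤ k → k ≤ (n : ℤ) →
      F n k = (a₁ * k + a₀) * F (n - 1) k + F (n - 1) (k - 1)) :
    ∀ n k : ℕ, k ≤ n →
      F n k = ∑ j ∈ Finset.Icc k n,
        (Nat.choose n j : ℝ) * a₀ ^ (n - j) * a₁ ^ (j - k) * (stirling2 j k : ℝ) := by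
  have key : ∀ n k : ℕ, F n k = ∑ j ∈ Finset.range (n + 1),
      (n.choose j : ℝ) * a₀ ^ (n - j) * (a₁ ^ (j - k) * (stirling2 j k : ℝ)) := by
    intro n
    induction n with
    | zero =>
      rintro (_ | k)
      · simpa [stirling2] using hinit
      · rw [hzero 0 _ (Or.inr (by positivity))]
        simp [stirling2]
    | succ n ih =>
      intro k
      rcases lt_or_ge (n + 1) k with hk | hk
      · rw [hzero _ _ (Or.inr (by exact_mod_cast hk))]
        refine (Finset.sum_eq_zero fun j hj => ?_).symm
        rw [stirling2_eq_zero_of_lt ((Finset.mem_range_succ_iff.mp hj).trans_lt hk)]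
        simp
      · rw [hrec (n + 1) (Nat.le_add_left 1 n) k (Int.natCast_nonneg k) (by exact_mod_cast hk),
          Nat.add_sub_cancel,
          sum_range_choose_succ_mul_pow_mul a₀ (fun j => a₁ ^ (j - k) * (stirling2 j k : ℝ)),
          ← ih k]
        cases k with
        | zero =>
          rw [hzero n (((0 : ℕ) : ℤ) - 1) (Or.inl (by norm_num))]
          simp only [pow_mul_stirling2_succ_zero]
          simp
        | succ k =>
          have hsum : ∑ j ∈ Finset.range (n + 1), (n.choose j : ℝ) * a₀ ^ (n - j) *
              (a₁ ^ (j + 1 - (k + 1)) * (stirling2 (j + 1) (k + 1) : ℝ)) =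
              a₁ * (k + 1) * F n (k + 1 : ℕ) + F n k := by
            rw [ih (k + 1), ih k, Finset.mul_sum, ← Finset.sum_add_distrib]
            refine Finset.sum_congr rfl fun j _ => ?_
            rw [pow_mul_stirling2_succ_succ]
            ring
          rw [hsum, show ((k + 1 : ℕ) : ℤ) - 1 = k by simp, Int.cast_natCast, Nat.cast_succ]
          ring
  intro n k _
  simp only [key, mul_assoc]
  refine (Finset.sum_subset (fun j hj => ?_) fun j _ hj => ?_).symm
  · simp only [Finset.mem_Icc, Finset.mem_range] at hj ⊢
    omega
  · rw [stirling2_eq_zero_of_lt (by simp_all)]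
    simp
end
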